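/- Let I be a finite index set. Suppose given families of k-linear functionals f_ij = (f_ij^α: A_α → k)_{α∈π} (i, j ∈ I) satisfying f_ij^α(ab) = Σ_{h∈I} f_ih^α(a)·f_hj^α(b) and f_ij^α(1_α) = δ_ij, and families of elements R_ij^α ∈ A_α (i, j ∈ I, α ∈ π) satisfying Δ_{β,γ}(R_ji^{βγ}) = Σ_{h∈I} R_jh^β ⊗ R_hi^γ, ε(R_ji^1) = δ_ji, and Σ_{i∈I} R_ij^α·(a * f_ih) = Σ_{i∈I} (f_ji * a)·R_hi^α for all α ∈ π, a ∈ A_α and j, h ∈ I, where f * b := (id ⊗ f^1)(Δ_{α,1}(b)) and b * f := (f^1 ⊗ id)(Δ_{1,α}(b)). For each α ∈ π let Γ_α be the free left A_α-module with basis (ω_i^α)_{i∈I}, with right A_α-action determined by ω_i^α·b = Σ_{j∈I} (f_ij * b)·ω_j^α, and define Δ^l_{α,β}(a·ω_i^{αβ}) = Δ_{α,β}(a)·(1_α ⊗ ω_i^β) and Δ^r_{α,β}(a·ω_i^{αβ}) = Δ_{α,β}(a)·(Σ_{j∈I} ω_j^α ⊗ R_ji^β). Then Γ is an A-bimodule family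 (the right action is well defined and associative) and (Γ, Δ^l, Δ^r) is a π-graded bicovariant bimodule over A. -/

import Mathlib

open TensorProduct

/-- The componentwise action of `R ⊗[k] S` on `M ⊗[k] N` induced by `k`-bilinear
actions `f` of `R` on `M` and `g` of `S` on `N`: `(r ⊗ s) • (m ⊗ n) = (f r m) ⊗ (g s n)`. -/
noncomputable def tact {k : Type} [Field k] {R S M N : Type}
    [AddCommGroup R] [Module k R] [AddCommGroup S] [Module k S]
    [AddCommGroup M] [Module k M] [AddCommGroup N] [Module k N]
    (f : R →ₗ[k] M →ₗ[k] M) (g : S →ₗ[k] N →ₗ[k] N) :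
    R ⊗[k] S →ₗ[k] (M ⊗[k] N) →ₗ[k] M ⊗[k] N :=
  TensorProduct.lift (LinearMap.mk₂ k (fun r s => TensorProduct.map (f r) (g s))
    (fun r r' s => by simp only [map_add, TensorProduct.map_add_left])
    (fun c r s => by simp only [map_smul, TensorProduct.map_smul_left])
    (fun r s s' => by simp only [map_add, TensorProduct.map_add_right])
    (fun r c s => by simp only [map_smul, TensorProduct.map_smul_right]))

/-- `f * b := (id ⊗ f)(Δ_{α,1}(b)) ∈ A_α`, for a functional `f` on `A₁`. -/
noncomputable def fstarb {k : Type} [Field k] {G : Type} [Group G]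
    (A : G → Type) [∀ α, Ring (A α)] [∀ α, Algebra k (A α)]
    (Δ : ∀ α β γ : G, α * β = γ → (A γ →ₐ[k] A α ⊗[k] A β))
    (α : G) (φ : A 1 →ₗ[k] k) : A α →ₗ[k] A α :=
  (TensorProduct.rid k (A α)).toLinearMap ∘ₗ (LinearMap.lTensor (A α) φ) ∘ₗ
    (Δ α 1 α (mul_one α)).toLinearMap

/-- `b * f := (f ⊗ id)(Δ_{1,α}(b)) ∈ A_α`, for a functional `f` on `A₁`. -/
noncomputable def bstarf {k : Type} [Field k] {G : Type} [Group G]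
    (A : G → Type) [∀ α, Ring (A α)] [∀ α, Algebra k (A α)]
    (Δ : ∀ α β γ : G, α * β = γ → (A γ →ₐ[k] A α ⊗[k] A β))
    (α : G) (φ : A 1 →ₗ[k] k) : A α →ₗ[k] A α :=
  (TensorProduct.lid k (A α)).toLinearMap ∘ₗ (LinearMap.rTensor (A α) φ) ∘ₗ
    (Δ 1 α α (one_mul α)).toLinearMap

/-- The left action of `A_α` on the free module `I → A_α`. -/
noncomputable def piSl (k : Type) [Field k] {I : Type} [Fintype I]
    (R : Type) [Ring R] [Algebra k R] :
    R →ₗ[k] (I → R) →ₗ[k] (I → R) :=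
  LinearMap.mk₂ k (fun a v i => a * v i)
    (fun a a' v => by funext i; simp [add_mul])
    (fun c a v => by funext i; simp [smul_mul_assoc])
    (fun a v v' => by funext i; simp [mul_add])
    (fun a c v => by funext i; simp [mul_smul_comm])

/-- The right action of `A_α` on the free module `I → A_α` determined by the
functionals `f_ij` via `ω_i · b = Σ_j (f_ij * b) · ω_j`. -/
noncomputable def piSr {k : Type} [Field k] {G : Type} [Group G]
    (A : G → Type) [∀ α, Ring (A α)] [∀ α, Algebra k (A α)]
    (Δ : ∀ α β γ : G, α * β = γ → (A γ →ₐ[k] A α ⊗[k] A β))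
    {I : Type} [Fintype I]
    (f : I → I → (A 1 →ₗ[k] k)) (α : G) :
    A α →ₗ[k] (I → A α) →ₗ[k] (I → A α) :=
  LinearMap.mk₂ k (fun b v j => ∑ i, v i * fstarb A Δ α (f i j) b)
    (fun b b' v => by funext j; simp [map_add, mul_add, Finset.sum_add_distrib])
    (fun c b v => by funext j; simp [map_smul, mul_smul_comm, Finset.smul_sum])
    (fun b v v' => by funext j; simp [add_mul, Finset.sum_add_distrib])
    (fun b c v => by funext j; simp [smul_mul_assoc, Finset.smul_sum])

/-- The left coaction `Δˡ_{α,β}` on the free module, determined by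
`Δˡ(a·ω_i) = Δ(a)·(1_α ⊗ ω_i)`. -/
noncomputable def DlFree {k : Type} [Field k] {G : Type} [Group G]
    (A : G → Type) [∀ α, Ring (A α)] [∀ α, Algebra k (A α)]
    (Δ : ∀ α β γ : G, α * β = γ → (A γ →ₐ[k] A α ⊗[k] A β))
    (I : Type) [Fintype I] [DecidableEq I]
    (α β γ : G) (h : α * β = γ) :
    (I → A γ) →ₗ[k] A α ⊗[k] (I → A β) :=
  ∑ i : I, (LinearMap.lTensor (A α) (LinearMap.single k (fun _ : I => A β) i)) ∘ₗ
    (Δ α β γ h).toLinearMap ∘ₗ (LinearMap.proj i)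

/-- The right coaction `Δʳ_{α,β}` on the free module, determined by
`Δʳ(a·ω_i) = Δ(a)·(Σ_j ω_j ⊗ R_ji)`. -/
noncomputable def DrFree {k : Type} [Field k] {G : Type} [Group G]
    (A : G → Type) [∀ α, Ring (A α)] [∀ α, Algebra k (A α)]
    (Δ : ∀ α β γ : G, α * β = γ → (A γ →ₐ[k] A α ⊗[k] A β))
    (I : Type) [Fintype I] [DecidableEq I]
    (Rm : ∀ β : G, I → I → A β)
    (α β γ : G) (h : α * β = γ) :
    (I → A γ) →ₗ[k] (I → A α) ⊗[k] A β :=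
  ∑ i : I, ∑ j : I,
    (TensorProduct.map (LinearMap.single k (fun _ : I => A α) j)
        (LinearMap.mulRight k (Rm β j i))) ∘ₗ
      (Δ α β γ h).toLinearMap ∘ₗ (LinearMap.proj i)

section HelperLemmas

variable {k : Type} [Field k]

lemma tact_tmul {R S M N : Type}
    [AddCommGroup R] [Module k R] [AddCommGroup S] [Module k S]
    [AddCommGroup M] [Module k M] [AddCommGroup N] [Module k N]
    (f : R →ₗ[k] M →ₗ[k] M) (g : S →ₗ[k] N →ₗ[k] N) (r : R) (s : S) (m : M) (n : N) :
    tact f g (r ⊗ₜ[k] s) (m ⊗ₜ[k] n) = f r m ⊗ₜ[k] g s n := rfl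

lemma TensorProduct.map_mulRight_mulRight {R S : Type} [Ring R] [Algebra k R] [Ring S]
    [Algebra k S] (a : R) (b : S) (z : R ⊗[k] S) :
    TensorProduct.map (LinearMap.mulRight k a) (LinearMap.mulRight k b) z = z * (a ⊗ₜ[k] b) := by
  induction z with
  | zero => simp
  | tmul x y => simp
  | add x y hx hy => simp only [map_add, add_mul, hx, hy]

variable {I : Type} [Fintype I]

@[simp]
lemma piSl_apply {R : Type} [Ring R] [Algebra k R] (a : R) (v : I → R) (i : I) :
    piSl k R a v i = a * v i := rfl

lemma piSl_single [DecidableEq I] {R : Type} [Ring R] [Algebra k R] (a b : R) (i : I) :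
    piSl k R a (Pi.single i b) = Pi.single i (a * b) := by
  funext j
  by_cases h : j = i
  · subst h; simp
  · simp [h]

lemma tact_mul_piSl_lTensor_single [DecidableEq I] {R S : Type} [Ring R] [Algebra k R] [Ring S]
    [Algebra k S] (i : I) (x y : R ⊗[k] S) :
    tact (LinearMap.mul k R) (piSl k S) x
        (LinearMap.lTensor R (LinearMap.single k (fun _ : I => S) i) y)
      = LinearMap.lTensor R (LinearMap.single k (fun _ : I => S) i) (x * y) := by
  induction x with
  | zero => simp
  | add x x' hx hx' => simp only [map_add, add_mul, hx, hx', LinearMap.add_apply]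
  | tmul a b =>
    induction y with
    | zero => simp
    | add y y' hy hy' => simp only [map_add, mul_add, hy, hy']
    | tmul c d => simp [tact_tmul, piSl_single]

lemma tact_piSl_mul_map_single_mulRight [DecidableEq I] {R S : Type} [Ring R] [Algebra k R]
    [Ring S] [Algebra k S] (i : I) (r : S) (x y : R ⊗[k] S) :
    tact (piSl k R) (LinearMap.mul k S) x
        (TensorProduct.map (LinearMap.single k (fun _ : I => R) i) (LinearMap.mulRight k r) y)
      = TensorProduct.map (LinearMap.single k (fun _ : I => R) i) (LinearMap.mulRight k r)
          (x * y) := by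
  induction x with
  | zero => simp
  | add x x' hx hx' => simp only [map_add, add_mul, hx, hx', LinearMap.add_apply]
  | tmul a b =>
    induction y with
    | zero => simp
    | add y y' hy hy' => simp only [map_add, mul_add, hy, hy']
    | tmul c d => simp [tact_tmul, piSl_single, mul_assoc]

variable {G : Type} [Group G] {A : G → Type} [∀ α, Ring (A α)] [∀ α, Algebra k (A α)]
  {Δ : ∀ α β γ : G, α * β = γ → (A γ →ₐ[k] A α ⊗[k] A β)}

lemma fstarb_apply (α : G) (φ : A 1 →ₗ[k] k) (a : A α) :
    fstarb A Δ α φ a = TensorProduct.rid k (A α)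
      (LinearMap.lTensor (A α) φ (Δ α 1 α (mul_one α) a)) := rfl

lemma bstarf_apply (α : G) (φ : A 1 →ₗ[k] k) (a : A α) :
    bstarf A Δ α φ a = TensorProduct.lid k (A α)
      (LinearMap.rTensor (A α) φ (Δ 1 α α (one_mul α) a)) := rfl

lemma fstarb_one (α : G) (φ : A 1 →ₗ[k] k) : fstarb A Δ α φ 1 = φ 1 • (1 : A α) := by
  rw [fstarb_apply, map_one, Algebra.TensorProduct.one_def]
  simp

lemma fstarb_mul (f : I → I → A 1 →ₗ[k] k)
    (hf : ∀ (a b : A 1) (i j : I), f i j (a * b) = ∑ h, f i h a * f h j b)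
    (α : G) (a b : A α) (i j : I) :
    fstarb A Δ α (f i j) (a * b)
      = ∑ h, fstarb A Δ α (f i h) a * fstarb A Δ α (f h j) b := by
  simp only [fstarb_apply, map_mul]
  generalize Δ α 1 α (mul_one α) a = x
  generalize Δ α 1 α (mul_one α) b = y
  induction x with
  | zero => simp
  | add x x' hx hx' => simp only [map_add, add_mul, hx, hx', Finset.sum_add_distrib]
  | tmul p q =>
    induction y with
    | zero => simp
    | add y y' hy hy' => simp only [map_add, mul_add, hy, hy', Finset.sum_add_distrib]
    | tmul r s => simp [hf, Finset.sum_smul, smul_smul, mul_comm]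

lemma piSr_apply (f : I → I → A 1 →ₗ[k] k) (α : G) (b : A α) (v : I → A α) (j : I) :
    piSr A Δ f α b v j = ∑ i, v i * fstarb A Δ α (f i j) b := rfl

lemma piSr_single [DecidableEq I] (f : I → I → A 1 →ₗ[k] k) (α : G) (b c : A α) (i : I) :
    piSr A Δ f α b (Pi.single i c) = ∑ j, Pi.single j (c * fstarb A Δ α (f i j) b) := by
  funext j
  simp [piSr_apply, Finset.sum_apply, Pi.single_apply]

lemma DlFree_apply [DecidableEq I] (α β γ : G) (h : α * β = γ) (ρ : I → A γ) :
    DlFree A Δ I α β γ h ρ = ∑ i, LinearMap.lTensor (A α)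
      (LinearMap.single k (fun _ : I => A β) i) (Δ α β γ h (ρ i)) := by
  simp [DlFree]

lemma DlFree_single [DecidableEq I] (α β γ : G) (h : α * β = γ) (i : I) (a : A γ) :
    DlFree A Δ I α β γ h (Pi.single i a) = LinearMap.lTensor (A α)
      (LinearMap.single k (fun _ : I => A β) i) (Δ α β γ h a) := by
  rw [DlFree_apply, Finset.sum_eq_single i]
  · simp
  · intro j _ hj; simp [hj]
  · simp

lemma DrFree_apply [DecidableEq I] (Rm : ∀ β : G, I → I → A β) (α β γ : G) (h : α * β = γ)
    (ρ : I → A γ) :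
    DrFree A Δ I Rm α β γ h ρ = ∑ i, ∑ j, TensorProduct.map
      (LinearMap.single k (fun _ : I => A α) j) (LinearMap.mulRight k (Rm β j i))
      (Δ α β γ h (ρ i)) := by
  simp [DrFree]

lemma DrFree_single [DecidableEq I] (Rm : ∀ β : G, I → I → A β) (α β γ : G) (h : α * β = γ)
    (i : I) (a : A γ) :
    DrFree A Δ I Rm α β γ h (Pi.single i a) = ∑ j, TensorProduct.map
      (LinearMap.single k (fun _ : I => A α) j) (LinearMap.mulRight k (Rm β j i))
      (Δ α β γ h a) := by
  rw [DrFree_apply, Finset.sum_eq_single i]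
  · simp
  · intro j _ hj; simp [hj]
  · simp

lemma tact_flip_piSr_lTensor_single [DecidableEq I] (f : I → I → A 1 →ₗ[k] k) (α β : G) (i : I)
    (x y : A α ⊗[k] A β) :
    tact (LinearMap.mul k (A α)).flip (piSr A Δ f β) x
        (LinearMap.lTensor (A α) (LinearMap.single k (fun _ : I => A β) i) y)
      = ∑ j, LinearMap.lTensor (A α) (LinearMap.single k (fun _ : I => A β) j)
          (y * LinearMap.lTensor (A α) (fstarb A Δ β (f i j)) x) := by
  induction x with
  | zero => simp
  | add x x' hx hx' =>
    simp only [map_add, mul_add, hx, hx', LinearMap.add_apply, Finset.sum_add_distrib]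
  | tmul a b =>
    induction y with
    | zero => simp
    | add y y' hy hy' => simp only [map_add, add_mul, hy, hy', Finset.sum_add_distrib]
    | tmul c d => simp [tact_tmul, piSr_single, TensorProduct.tmul_sum]

lemma tact_piSr_flip_map_single_mulRight [DecidableEq I] (f : I → I → A 1 →ₗ[k] k) (α β : G)
    (j : I) (r : A β) (x y : A α ⊗[k] A β) :
    tact (piSr A Δ f α) (LinearMap.mul k (A β)).flip x
        (TensorProduct.map (LinearMap.single k (fun _ : I => A α) j) (LinearMap.mulRight k r) y)
      = ∑ l, LinearMap.rTensor (A β) (LinearMap.single k (fun _ : I => A α) l)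
          (y * ((1 ⊗ₜ[k] r) * LinearMap.rTensor (A β) (fstarb A Δ α (f j l)) x)) := by
  induction x with
  | zero => simp
  | add x x' hx hx' =>
    simp only [map_add, mul_add, hx, hx', LinearMap.add_apply, Finset.sum_add_distrib]
  | tmul a b =>
    induction y with
    | zero => simp
    | add y y' hy hy' => simp only [map_add, add_mul, hy, hy', Finset.sum_add_distrib]
    | tmul c d => simp [tact_tmul, piSr_single, TensorProduct.sum_tmul, mul_assoc]

lemma coassoc_of_eq
    (hcoassoc : ∀ (α β γ : G) (x : A (α * β * γ)),
      (TensorProduct.assoc k (A α) (A β) (A γ))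
          ((Algebra.TensorProduct.map (Δ α β (α * β) rfl) (AlgHom.id k (A γ)))
            ((Δ (α * β) γ (α * β * γ) rfl) x))
        = (Algebra.TensorProduct.map (AlgHom.id k (A α)) (Δ β γ (β * γ) rfl))
            ((Δ α (β * γ) (α * β * γ) (mul_assoc α β γ).symm) x))
    {α β γ δ η ζ : G} (h₁ : α * β = δ) (h₂ : β * γ = η) (h₃ : δ * γ = ζ) (h₄ : α * η = ζ)
    (x : A ζ) :
    TensorProduct.assoc k (A α) (A β) (A γ)
        (LinearMap.rTensor (A γ) (Δ α β δ h₁).toLinearMap (Δ δ γ ζ h₃ x))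
      = LinearMap.lTensor (A α) (Δ β γ η h₂).toLinearMap (Δ α η ζ h₄ x) := by
  subst h₁ h₂ h₃
  exact hcoassoc α β γ x

lemma comul_fstarb
    (hcoassoc : ∀ (α β γ : G) (x : A (α * β * γ)),
      (TensorProduct.assoc k (A α) (A β) (A γ))
          ((Algebra.TensorProduct.map (Δ α β (α * β) rfl) (AlgHom.id k (A γ)))
            ((Δ (α * β) γ (α * β * γ) rfl) x))
        = (Algebra.TensorProduct.map (AlgHom.id k (A α)) (Δ β γ (β * γ) rfl))
            ((Δ α (β * γ) (α * β * γ) (mul_assoc α β γ).symm) x))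
    (α β γ : G) (h : α * β = γ) (φ : A 1 →ₗ[k] k) (a : A γ) :
    Δ α β γ h (fstarb A Δ γ φ a)
      = LinearMap.lTensor (A α) (fstarb A Δ β φ) (Δ α β γ h a) := by
  have key := coassoc_of_eq hcoassoc h (mul_one β) (mul_one γ) h a
  have h₁ : ∀ z : A γ ⊗[k] A 1,
      Δ α β γ h (TensorProduct.rid k (A γ) (LinearMap.lTensor (A γ) φ z))
        = LinearMap.lTensor (A α) ((TensorProduct.rid k (A β)).toLinearMap ∘ₗ
            LinearMap.lTensor (A β) φ) (TensorProduct.assoc k (A α) (A β) (A 1)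
              (LinearMap.rTensor (A 1) (Δ α β γ h).toLinearMap z)) := by
    intro z
    induction z with
    | zero => simp
    | add x y hx hy => simp only [map_add, hx, hy]
    | tmul p q =>
      simp only [LinearMap.lTensor_tmul, TensorProduct.rid_tmul, map_smul,
        LinearMap.rTensor_tmul, AlgHom.toLinearMap_apply]
      generalize Δ α β γ h p = w
      induction w with
      | zero => simp
      | add x y hx hy => simp only [smul_add, map_add, TensorProduct.add_tmul, hx, hy]
      | tmul r s => simp
  rw [fstarb_apply, h₁, key, ← LinearMap.comp_apply, ← LinearMap.lTensor_comp]
  rfl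

lemma rTensor_fstarb_comul
    (hcoassoc : ∀ (α β γ : G) (x : A (α * β * γ)),
      (TensorProduct.assoc k (A α) (A β) (A γ))
          ((Algebra.TensorProduct.map (Δ α β (α * β) rfl) (AlgHom.id k (A γ)))
            ((Δ (α * β) γ (α * β * γ) rfl) x))
        = (Algebra.TensorProduct.map (AlgHom.id k (A α)) (Δ β γ (β * γ) rfl))
            ((Δ α (β * γ) (α * β * γ) (mul_assoc α β γ).symm) x))
    (α β γ : G) (h : α * β = γ) (φ : A 1 →ₗ[k] k) (a : A γ) :
    LinearMap.rTensor (A β) (fstarb A Δ α φ) (Δ α β γ h a)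
      = LinearMap.lTensor (A α) (bstarf A Δ β φ) (Δ α β γ h a) := by
  have key := coassoc_of_eq hcoassoc (mul_one α) (one_mul β) h h a
  have h₁ : ∀ z : A α ⊗[k] A β,
      LinearMap.rTensor (A β) (fstarb A Δ α φ) z
        = LinearMap.lTensor (A α) ((TensorProduct.lid k (A β)).toLinearMap ∘ₗ
            LinearMap.rTensor (A β) φ) (TensorProduct.assoc k (A α) (A 1) (A β)
              (LinearMap.rTensor (A β) (Δ α 1 α (mul_one α)).toLinearMap z)) := by
    intro z
    induction z with
    | zero => simp
    | add x y hx hy => simp only [map_add, hx, hy]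
    | tmul p q =>
      simp only [LinearMap.rTensor_tmul, AlgHom.toLinearMap_apply, fstarb_apply]
      generalize Δ α 1 α (mul_one α) p = w
      induction w with
      | zero => simp
      | add x y hx hy => simp only [map_add, TensorProduct.add_tmul, hx, hy]
      | tmul r s => simp [TensorProduct.smul_tmul]
  rw [h₁, key, ← LinearMap.comp_apply, ← LinearMap.lTensor_comp]
  rfl

lemma sum_one_tmul_mul_lTensor_bstarf (f : I → I → A 1 →ₗ[k] k) (Rm : ∀ β : G, I → I → A β)
    (hRf : ∀ (α : G) (a : A α) (j h : I),
      (∑ i, (Rm α i j) * (bstarf A Δ α (f i h) a))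
        = ∑ i, (fstarb A Δ α (f j i) a) * (Rm α h i))
    (α β : G) (j h : I) (x : A α ⊗[k] A β) :
    ∑ i, (1 ⊗ₜ[k] Rm β i j) * LinearMap.lTensor (A α) (bstarf A Δ β (f i h)) x
      = ∑ i, LinearMap.lTensor (A α) (fstarb A Δ β (f j i)) x * (1 ⊗ₜ[k] Rm β h i) := by
  induction x with
  | zero => simp
  | add x y hx hy => simp only [map_add, mul_add, add_mul, Finset.sum_add_distrib, hx, hy]
  | tmul a b => simp [← TensorProduct.tmul_sum, hRf]

lemma eq_of_apply_single [DecidableEq I] {R M : Type} [Ring R] [Algebra k R] [AddCommGroup M]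
    [Module k M] {F H : (I → R) →ₗ[k] M} (h : ∀ i a, F (Pi.single i a) = H (Pi.single i a))
    (v : I → R) : F v = H v :=
  LinearMap.congr_fun (LinearMap.pi_ext h) v

lemma DlFree_coassoc [DecidableEq I]
    (hcoassoc : ∀ (α β γ : G) (x : A (α * β * γ)),
      (TensorProduct.assoc k (A α) (A β) (A γ))
          ((Algebra.TensorProduct.map (Δ α β (α * β) rfl) (AlgHom.id k (A γ)))
            ((Δ (α * β) γ (α * β * γ) rfl) x))
        = (Algebra.TensorProduct.map (AlgHom.id k (A α)) (Δ β γ (β * γ) rfl))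
            ((Δ α (β * γ) (α * β * γ) (mul_assoc α β γ).symm) x))
    (α β γ : G) (ρ : I → A (α * β * γ)) :
    (TensorProduct.assoc k (A α) (A β) (I → A γ))
        ((LinearMap.rTensor (I → A γ) (Δ α β (α * β) rfl).toLinearMap)
          (DlFree A Δ I (α * β) γ (α * β * γ) rfl ρ))
      = (LinearMap.lTensor (A α) (DlFree A Δ I β γ (β * γ) rfl))
          (DlFree A Δ I α (β * γ) (α * β * γ) (mul_assoc α β γ).symm ρ) := by
  refine eq_of_apply_single (F := (TensorProduct.assoc k _ _ _).toLinearMap ∘ₗ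
    LinearMap.rTensor (I → A γ) (Δ α β (α * β) rfl).toLinearMap ∘ₗ
     DlFree A Δ I (α * β) γ (α * β * γ) rfl)
    (H := LinearMap.lTensor (A α) (DlFree A Δ I β γ (β * γ) rfl) ∘ₗ
      DlFree A Δ I α (β * γ) (α * β * γ) (mul_assoc α β γ).symm) (fun i a => ?_) ρ
  have key := coassoc_of_eq hcoassoc (α := α) (β := β) (γ := γ) rfl rfl rfl
    (mul_assoc α β γ).symm a
  simp only [LinearMap.comp_apply, DlFree_single, LinearEquiv.coe_coe]
  have h₁ : ∀ z : A (α * β) ⊗[k] A γ,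
      TensorProduct.assoc k (A α) (A β) (I → A γ)
        (LinearMap.rTensor (I → A γ) (Δ α β (α * β) rfl).toLinearMap
          (LinearMap.lTensor (A (α * β)) (LinearMap.single k (fun _ : I => A γ) i) z))
      = LinearMap.lTensor (A α) (LinearMap.lTensor (A β)
          (LinearMap.single k (fun _ : I => A γ) i)) (TensorProduct.assoc k (A α) (A β) (A γ)
            (LinearMap.rTensor (A γ) (Δ α β (α * β) rfl).toLinearMap z)) := by
    intro z
    induction z with
    | zero => simp
    | add x y hx hy => simp only [map_add, hx, hy]
    | tmul p q =>
      simp only [LinearMap.rTensor_tmul, LinearMap.lTensor_tmul, AlgHom.toLinearMap_apply]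
      generalize Δ α β (α * β) rfl p = w
      induction w with
      | zero => simp
      | add x y hx hy => simp only [map_add, TensorProduct.add_tmul, hx, hy]
      | tmul r s => simp
  rw [h₁, key]
  simp only [← LinearMap.comp_apply, ← LinearMap.lTensor_comp]
  congr 2
  ext b
  simp [DlFree_single]

lemma DlFree_counit [DecidableEq I]
    (ε : A 1 →ₐ[k] k)
    (hcounit₂ : ∀ (α : G) (x : A α),
      (TensorProduct.lid k (A α)) ((LinearMap.rTensor (A α) ε.toLinearMap)
        ((Δ 1 α α (one_mul α)) x)) = x)
    (α : G) (ρ : I → A α) :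
    (TensorProduct.lid k (I → A α))
      ((LinearMap.rTensor (I → A α) ε.toLinearMap)
        (DlFree A Δ I 1 α α (one_mul α) ρ)) = ρ := by
  refine eq_of_apply_single (F := (TensorProduct.lid k _).toLinearMap ∘ₗ
    LinearMap.rTensor (I → A α) ε.toLinearMap ∘ₗ DlFree A Δ I 1 α α (one_mul α))
    (H := LinearMap.id) (fun i a => ?_) ρ
  simp only [LinearMap.comp_apply, DlFree_single, LinearEquiv.coe_coe, LinearMap.id_apply]
  have h₁ : ∀ z : A 1 ⊗[k] A α,
      TensorProduct.lid k (I → A α) (LinearMap.rTensor (I → A α) ε.toLinearMap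
        (LinearMap.lTensor (A 1) (LinearMap.single k (fun _ : I => A α) i) z))
      = Pi.single i (TensorProduct.lid k (A α)
          (LinearMap.rTensor (A α) ε.toLinearMap z)) := by
    intro z
    induction z with
    | zero => simp
    | add x y hx hy => simp only [map_add, hx, hy, Pi.single_add]
    | tmul p q => simp [Pi.single_smul]
  rw [h₁, hcounit₂]

lemma DrFree_piSr [DecidableEq I]
    (hcoassoc : ∀ (α β γ : G) (x : A (α * β * γ)),
      (TensorProduct.assoc k (A α) (A β) (A γ))
          ((Algebra.TensorProduct.map (Δ α β (α * β) rfl) (AlgHom.id k (A γ)))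
            ((Δ (α * β) γ (α * β * γ) rfl) x))
        = (Algebra.TensorProduct.map (AlgHom.id k (A α)) (Δ β γ (β * γ) rfl))
            ((Δ α (β * γ) (α * β * γ) (mul_assoc α β γ).symm) x))
    (Rm : ∀ β : G, I → I → A β)
    (f : I → I → A 1 →ₗ[k] k)
    (hRf : ∀ (α : G) (a : A α) (j h : I),
      (∑ i, (Rm α i j) * (bstarf A Δ α (f i h) a))
        = ∑ i, (fstarb A Δ α (f j i) a) * (Rm α h i))
    (α β γ : G) (h : α * β = γ) (a : A γ) (ρ : I → A γ) :
    DrFree A Δ I Rm α β γ h (piSr A Δ f γ a ρ)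
      = tact (piSr A Δ f α) ((LinearMap.mul k (A β)).flip)
          ((Δ α β γ h) a) (DrFree A Δ I Rm α β γ h ρ) := by
  have h₁ : ∀ (j : I) (r : A β) (z : A α ⊗[k] A β),
      TensorProduct.map (LinearMap.single k (fun _ : I => A α) j) (LinearMap.mulRight k r) z
      = LinearMap.rTensor (A β) (LinearMap.single k (fun _ : I => A α) j)
          (z * (1 ⊗ₜ[k] r)) := by
    intro j r z
    induction z with
    | zero => simp
    | add x y hx hy => simp only [map_add, add_mul, hx, hy]
    | tmul p q => simp
  have h₂ := sum_one_tmul_mul_lTensor_bstarf f Rm hRf α β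
  simp only [DrFree_apply, map_sum, tact_piSr_flip_map_single_mulRight,
    rTensor_fstarb_comul hcoassoc, piSr_apply, map_mul, comul_fstarb hcoassoc]
  simp only [h₁, mul_assoc]
  calc _ = ∑ i, ∑ l, LinearMap.rTensor (A β) (LinearMap.single k (fun _ : I => A α) l)
        (Δ α β γ h (ρ i) * ∑ j, LinearMap.lTensor (A α) (fstarb A Δ β (f i j))
          (Δ α β γ h a) * (1 ⊗ₜ[k] Rm β l j)) := by
        simp only [Finset.mul_sum, map_sum]
        rw [Finset.sum_comm]
        rw [Finset.sum_congr rfl fun _ _ => Finset.sum_comm]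
        rw [Finset.sum_comm]
    _ = _ := by
        simp only [← h₂, Finset.mul_sum, map_sum]
        exact Finset.sum_congr rfl fun _ _ => Finset.sum_comm

lemma DrFree_coassoc [DecidableEq I]
    (hcoassoc : ∀ (α β γ : G) (x : A (α * β * γ)),
      (TensorProduct.assoc k (A α) (A β) (A γ))
          ((Algebra.TensorProduct.map (Δ α β (α * β) rfl) (AlgHom.id k (A γ)))
            ((Δ (α * β) γ (α * β * γ) rfl) x))
        = (Algebra.TensorProduct.map (AlgHom.id k (A α)) (Δ β γ (β * γ) rfl))
            ((Δ α (β * γ) (α * β * γ) (mul_assoc α β γ).symm) x))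
    (Rm : ∀ β : G, I → I → A β)
    (hRΔ : ∀ (β γ : G) (j i : I),
      (Δ β γ (β * γ) rfl) (Rm (β * γ) j i) = ∑ h, (Rm β j h) ⊗ₜ[k] (Rm γ h i))
    (α β γ : G) (ρ : I → A (α * β * γ)) :
    (LinearMap.lTensor (I → A α) (Δ β γ (β * γ) rfl).toLinearMap)
        (DrFree A Δ I Rm α (β * γ) (α * β * γ) (mul_assoc α β γ).symm ρ)
      = (TensorProduct.assoc k (I → A α) (A β) (A γ))
          ((LinearMap.rTensor (A γ) (DrFree A Δ I Rm α β (α * β) rfl))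
            (DrFree A Δ I Rm (α * β) γ (α * β * γ) rfl ρ)) := by
  refine eq_of_apply_single (F :=
    LinearMap.lTensor (I → A α) (Δ β γ (β * γ) rfl).toLinearMap ∘ₗ
    DrFree A Δ I Rm α (β * γ) (α * β * γ) (mul_assoc α β γ).symm)
    (H := (TensorProduct.assoc k _ _ _).toLinearMap ∘ₗ
      LinearMap.rTensor (A γ) (DrFree A Δ I Rm α β (α * β) rfl) ∘ₗ
      DrFree A Δ I Rm (α * β) γ (α * β * γ) rfl) (fun i a => ?_) ρ
  have key := coassoc_of_eq hcoassoc (α := α) (β := β) (γ := γ) rfl rfl rfl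
    (mul_assoc α β γ).symm a
  simp only [LinearMap.comp_apply, DrFree_single, LinearEquiv.coe_coe, map_sum]
  have h₁ : ∀ (j : I) (z : A α ⊗[k] A (β * γ)),
      LinearMap.lTensor (I → A α) (Δ β γ (β * γ) rfl).toLinearMap
        (TensorProduct.map (LinearMap.single k (fun _ : I => A α) j)
          (LinearMap.mulRight k (Rm (β * γ) j i)) z)
      = ∑ h, TensorProduct.map (LinearMap.single k (fun _ : I => A α) j)
          (TensorProduct.map (LinearMap.mulRight k (Rm β j h))
            (LinearMap.mulRight k (Rm γ h i)))
          (LinearMap.lTensor (A α) (Δ β γ (β * γ) rfl).toLinearMap z) := by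
    intro j z
    induction z with
    | zero => simp
    | add x y hx hy => simp only [map_add, hx, hy, Finset.sum_add_distrib]
    | tmul p q =>
      simp [TensorProduct.map_mulRight_mulRight, hRΔ, Finset.mul_sum, TensorProduct.tmul_sum]
  have h₂ : ∀ (h : I) (z : A (α * β) ⊗[k] A γ),
      TensorProduct.assoc k (I → A α) (A β) (A γ)
        (LinearMap.rTensor (A γ) (DrFree A Δ I Rm α β (α * β) rfl)
          (TensorProduct.map (LinearMap.single k (fun _ : I => A (α * β)) h)
            (LinearMap.mulRight k (Rm γ h i)) z))
      = ∑ j, TensorProduct.map (LinearMap.single k (fun _ : I => A α) j)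
          (TensorProduct.map (LinearMap.mulRight k (Rm β j h))
            (LinearMap.mulRight k (Rm γ h i)))
          (TensorProduct.assoc k (A α) (A β) (A γ)
            (LinearMap.rTensor (A γ) (Δ α β (α * β) rfl).toLinearMap z)) := by
    intro h z
    induction z with
    | zero => simp
    | add x y hx hy => simp only [map_add, hx, hy, Finset.sum_add_distrib]
    | tmul p q =>
      simp only [LinearMap.rTensor_tmul, TensorProduct.map_tmul, LinearMap.coe_single,
        DrFree_single, AlgHom.toLinearMap_apply, TensorProduct.sum_tmul, map_sum]
      refine Finset.sum_congr rfl fun j _ => ?_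
      generalize Δ α β (α * β) rfl p = w
      induction w with
      | zero => simp
      | add x y hx hy => simp only [map_add, TensorProduct.add_tmul, hx, hy]
      | tmul r s => simp
  simp only [h₁, h₂, key]
  exact Finset.sum_comm

lemma DrFree_counit [DecidableEq I]
    (ε : A 1 →ₐ[k] k)
    (hcounit₁ : ∀ (α : G) (x : A α),
      (TensorProduct.rid k (A α)) ((LinearMap.lTensor (A α) ε.toLinearMap)
        ((Δ α 1 α (mul_one α)) x)) = x)
    (Rm : ∀ β : G, I → I → A β)
    (hRε : ∀ j i : I, ε (Rm 1 j i) = if j = i then (1 : k) else 0)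
    (α : G) (ρ : I → A α) :
    (TensorProduct.rid k (I → A α))
      ((LinearMap.lTensor (I → A α) ε.toLinearMap)
        (DrFree A Δ I Rm α 1 α (mul_one α) ρ)) = ρ := by
  refine eq_of_apply_single (F := (TensorProduct.rid k _).toLinearMap ∘ₗ
    LinearMap.lTensor (I → A α) ε.toLinearMap ∘ₗ DrFree A Δ I Rm α 1 α (mul_one α))
    (H := LinearMap.id) (fun i a => ?_) ρ
  simp only [LinearMap.comp_apply, DrFree_single, LinearEquiv.coe_coe, LinearMap.id_apply,
    map_sum]
  have h₁ : ∀ (j : I) (z : A α ⊗[k] A 1),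
      TensorProduct.rid k (I → A α) (LinearMap.lTensor (I → A α) ε.toLinearMap
        (TensorProduct.map (LinearMap.single k (fun _ : I => A α) j)
          (LinearMap.mulRight k (Rm 1 j i)) z))
      = if j = i then Pi.single j (TensorProduct.rid k (A α)
          (LinearMap.lTensor (A α) ε.toLinearMap z)) else 0 := by
    intro j z
    induction z with
    | zero => simp
    | add x y hx hy =>
      simp only [map_add, hx, hy, Pi.single_add]
      split_ifs <;> simp
    | tmul p q =>
      split_ifs with hji <;> simp [hRε, hji, Pi.single_smul]
  simp only [h₁, hcounit₁, Finset.sum_ite_eq', Finset.mem_univ, if_true]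

lemma DlFree_DrFree_comm [DecidableEq I]
    (hcoassoc : ∀ (α β γ : G) (x : A (α * β * γ)),
      (TensorProduct.assoc k (A α) (A β) (A γ))
          ((Algebra.TensorProduct.map (Δ α β (α * β) rfl) (AlgHom.id k (A γ)))
            ((Δ (α * β) γ (α * β * γ) rfl) x))
        = (Algebra.TensorProduct.map (AlgHom.id k (A α)) (Δ β γ (β * γ) rfl))
            ((Δ α (β * γ) (α * β * γ) (mul_assoc α β γ).symm) x))
    (Rm : ∀ β : G, I → I → A β)
    (α β γ : G) (ρ : I → A (α * β * γ)) :
    (TensorProduct.assoc k (A α) (I → A β) (A γ))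
        ((LinearMap.rTensor (A γ) (DlFree A Δ I α β (α * β) rfl))
          (DrFree A Δ I Rm (α * β) γ (α * β * γ) rfl ρ))
      = (LinearMap.lTensor (A α) (DrFree A Δ I Rm β γ (β * γ) rfl))
          (DlFree A Δ I α (β * γ) (α * β * γ) (mul_assoc α β γ).symm ρ) := by
  refine eq_of_apply_single (F := (TensorProduct.assoc k _ _ _).toLinearMap ∘ₗ
    LinearMap.rTensor (A γ) (DlFree A Δ I α β (α * β) rfl) ∘ₗ
      DrFree A Δ I Rm (α * β) γ (α * β * γ) rfl)
    (H := LinearMap.lTensor (A α) (DrFree A Δ I Rm β γ (β * γ) rfl) ∘ₗ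
      DlFree A Δ I α (β * γ) (α * β * γ) (mul_assoc α β γ).symm) (fun i a => ?_) ρ
  have key := coassoc_of_eq hcoassoc (α := α) (β := β) (γ := γ) rfl rfl rfl
    (mul_assoc α β γ).symm a
  simp only [LinearMap.comp_apply, DlFree_single, DrFree_single, LinearEquiv.coe_coe, map_sum]
  have h₁ : ∀ (j : I) (z : A (α * β) ⊗[k] A γ),
      TensorProduct.assoc k (A α) (I → A β) (A γ)
        (LinearMap.rTensor (A γ) (DlFree A Δ I α β (α * β) rfl)
          (TensorProduct.map (LinearMap.single k (fun _ : I => A (α * β)) j)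
            (LinearMap.mulRight k (Rm γ j i)) z))
      = LinearMap.lTensor (A α) (TensorProduct.map (LinearMap.single k (fun _ : I => A β) j)
          (LinearMap.mulRight k (Rm γ j i))) (TensorProduct.assoc k (A α) (A β) (A γ)
            (LinearMap.rTensor (A γ) (Δ α β (α * β) rfl).toLinearMap z)) := by
    intro j z
    induction z with
    | zero => simp
    | add x y hx hy => simp only [map_add, hx, hy]
    | tmul p q =>
      simp only [LinearMap.rTensor_tmul, TensorProduct.map_tmul, LinearMap.coe_single,
        DlFree_single, AlgHom.toLinearMap_apply]
      generalize Δ α β (α * β) rfl p = w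
      induction w with
      | zero => simp
      | add x y hx hy => simp only [map_add, TensorProduct.add_tmul, hx, hy]
      | tmul r s => simp
  have h₂ : ∀ z : A α ⊗[k] A (β * γ),
      LinearMap.lTensor (A α) (DrFree A Δ I Rm β γ (β * γ) rfl)
        (LinearMap.lTensor (A α) (LinearMap.single k (fun _ : I => A (β * γ)) i) z)
      = ∑ j, LinearMap.lTensor (A α)
          (TensorProduct.map (LinearMap.single k (fun _ : I => A β) j)
            (LinearMap.mulRight k (Rm γ j i)))
          (LinearMap.lTensor (A α) (Δ β γ (β * γ) rfl).toLinearMap z) := by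
    intro z
    induction z with
    | zero => simp
    | add x y hx hy => simp only [map_add, hx, hy, Finset.sum_add_distrib]
    | tmul p q => simp [DrFree_single, TensorProduct.tmul_sum]
  simp only [h₁, h₂, key]

end HelperLemmas

/-- Converse construction of bicovariant bimodules: given functionals
`f_ij` satisfying `f_ij(ab) = Σ_h f_ih(a) f_hj(b)` and `f_ij(1) = δ_ij`, and elements
`R_ij^α ∈ A_α` satisfying `Δ(R_ji) = Σ_h R_jh ⊗ R_hi`, `ε(R_ji) = δ_ji`, and
`Σ_i R_ij·(a * f_ih) = Σ_i (f_ji * a)·R_hi`, the free left modules `Γ_α = ⊕_i A_α ω_i`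
with right action `ω_i·b = Σ_j (f_ij * b)·ω_j` and the coactions
`Δˡ(a·ω_i) = Δ(a)(1 ⊗ ω_i)`, `Δʳ(a·ω_i) = Δ(a)(Σ_j ω_j ⊗ R_ji)` form a
`π`-graded bicovariant bimodule over `A`. -/
theorem free_bicovariant_bimodule_construction
    {k : Type} [Field k] {G : Type} [Group G]
    (A : G → Type) [∀ α, Ring (A α)] [∀ α, Algebra k (A α)]
    (Δ : ∀ α β γ : G, α * β = γ → (A γ →ₐ[k] A α ⊗[k] A β))
    (ε : A 1 →ₐ[k] k)
    (S : ∀ α β : G, α⁻¹ = β → (A α →ₗ[k] A β))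
    (hcoassoc : ∀ (α β γ : G) (x : A (α * β * γ)),
      (TensorProduct.assoc k (A α) (A β) (A γ))
          ((Algebra.TensorProduct.map (Δ α β (α * β) rfl) (AlgHom.id k (A γ)))
            ((Δ (α * β) γ (α * β * γ) rfl) x))
        = (Algebra.TensorProduct.map (AlgHom.id k (A α)) (Δ β γ (β * γ) rfl))
            ((Δ α (β * γ) (α * β * γ) (mul_assoc α β γ).symm) x))
    (hcounit₁ : ∀ (α : G) (x : A α),
      (TensorProduct.rid k (A α)) ((LinearMap.lTensor (A α) ε.toLinearMap)
        ((Δ α 1 α (mul_one α)) x)) = x)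
    (hcounit₂ : ∀ (α : G) (x : A α),
      (TensorProduct.lid k (A α)) ((LinearMap.rTensor (A α) ε.toLinearMap)
        ((Δ 1 α α (one_mul α)) x)) = x)
    (hantipode₁ : ∀ (α : G) (x : A 1),
      (LinearMap.mul' k (A α)) ((LinearMap.rTensor (A α) (S α⁻¹ α (inv_inv α)))
        ((Δ α⁻¹ α 1 (inv_mul_cancel α)) x)) = ε x • 1)
    (hantipode₂ : ∀ (α : G) (x : A 1),
      (LinearMap.mul' k (A α)) ((LinearMap.lTensor (A α) (S α⁻¹ α (inv_inv α)))
        ((Δ α α⁻¹ 1 (mul_inv_cancel α)) x)) = ε x • 1)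
    (I : Type) [Fintype I] [DecidableEq I]
    (f : I → I → ∀ α : G, A α →ₗ[k] k)
    (hf_mul : ∀ (α : G) (a b : A α) (i j : I),
      f i j α (a * b) = ∑ h : I, f i h α a * f h j α b)
    (hf_one : ∀ (α : G) (i j : I), f i j α 1 = if i = j then (1 : k) else 0)
    (Rm : ∀ β : G, I → I → A β)
    (hRΔ : ∀ (β γ : G) (j i : I),
      (Δ β γ (β * γ) rfl) (Rm (β * γ) j i) = ∑ h, (Rm β j h) ⊗ₜ[k] (Rm γ h i))
    (hRε : ∀ j i : I, ε (Rm 1 j i) = if j = i then (1 : k) else 0)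
    (hRf : ∀ (α : G) (a : A α) (j h : I),
      (∑ i, (Rm α i j) * (bstarf A Δ α (f i h 1) a))
        = ∑ i, (fstarb A Δ α (f j i 1) a) * (Rm α h i)) :
    -- (Γ_α = I → A_α, piSl, piSr) is a π-graded bimodule over A
    (∀ (α : G) (a b : A α) (v : I → A α),
      piSl k (A α) (a * b) v = piSl k (A α) a (piSl k (A α) b v))
    ∧ (∀ (α : G) (v : I → A α), piSl k (A α) (1 : A α) v = v)
    ∧ (∀ (α : G) (a b : A α) (v : I → A α),
      piSr A Δ (fun i j => f i j 1) α (a * b) v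
        = piSr A Δ (fun i j => f i j 1) α b (piSr A Δ (fun i j => f i j 1) α a v))
    ∧ (∀ (α : G) (v : I → A α), piSr A Δ (fun i j => f i j 1) α (1 : A α) v = v)
    ∧ (∀ (α : G) (a b : A α) (v : I → A α),
      piSl k (A α) a (piSr A Δ (fun i j => f i j 1) α b v)
        = piSr A Δ (fun i j => f i j 1) α b (piSl k (A α) a v))
    -- (Γ, Δˡ) is a left covariant π-graded bimodule
    ∧ (∀ (α β γ : G) (h : α * β = γ) (a : A γ) (ρ : I → A γ),
      DlFree A Δ I α β γ h (piSl k (A γ) a ρ)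
        = tact (LinearMap.mul k (A α)) (piSl k (A β)) ((Δ α β γ h) a)
            (DlFree A Δ I α β γ h ρ))
    ∧ (∀ (α β γ : G) (h : α * β = γ) (a : A γ) (ρ : I → A γ),
      DlFree A Δ I α β γ h (piSr A Δ (fun i j => f i j 1) γ a ρ)
        = tact ((LinearMap.mul k (A α)).flip) (piSr A Δ (fun i j => f i j 1) β)
            ((Δ α β γ h) a) (DlFree A Δ I α β γ h ρ))
    ∧ (∀ (α β γ : G) (ρ : I → A (α * β * γ)),
      (TensorProduct.assoc k (A α) (A β) (I → A γ))
          ((LinearMap.rTensor (I → A γ) (Δ α β (α * β) rfl).toLinearMap)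
            (DlFree A Δ I (α * β) γ (α * β * γ) rfl ρ))
        = (LinearMap.lTensor (A α) (DlFree A Δ I β γ (β * γ) rfl))
            (DlFree A Δ I α (β * γ) (α * β * γ) (mul_assoc α β γ).symm ρ))
    ∧ (∀ (α : G) (ρ : I → A α),
      (TensorProduct.lid k (I → A α))
        ((LinearMap.rTensor (I → A α) ε.toLinearMap)
          (DlFree A Δ I 1 α α (one_mul α) ρ)) = ρ)
    -- (Γ, Δʳ) is a right covariant π-graded bimodule
    ∧ (∀ (α β γ : G) (h : α * β = γ) (a : A γ) (ρ : I → A γ),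
      DrFree A Δ I Rm α β γ h (piSl k (A γ) a ρ)
        = tact (piSl k (A α)) (LinearMap.mul k (A β)) ((Δ α β γ h) a)
            (DrFree A Δ I Rm α β γ h ρ))
    ∧ (∀ (α β γ : G) (h : α * β = γ) (a : A γ) (ρ : I → A γ),
      DrFree A Δ I Rm α β γ h (piSr A Δ (fun i j => f i j 1) γ a ρ)
        = tact (piSr A Δ (fun i j => f i j 1) α) ((LinearMap.mul k (A β)).flip)
            ((Δ α β γ h) a) (DrFree A Δ I Rm α β γ h ρ))
    ∧ (∀ (α β γ : G) (ρ : I → A (α * β * γ)),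
      (LinearMap.lTensor (I → A α) (Δ β γ (β * γ) rfl).toLinearMap)
          (DrFree A Δ I Rm α (β * γ) (α * β * γ) (mul_assoc α β γ).symm ρ)
        = (TensorProduct.assoc k (I → A α) (A β) (A γ))
            ((LinearMap.rTensor (A γ) (DrFree A Δ I Rm α β (α * β) rfl))
              (DrFree A Δ I Rm (α * β) γ (α * β * γ) rfl ρ)))
    ∧ (∀ (α : G) (ρ : I → A α),
      (TensorProduct.rid k (I → A α))
        ((LinearMap.lTensor (I → A α) ε.toLinearMap)
          (DrFree A Δ I Rm α 1 α (mul_one α) ρ)) = ρ)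
    -- bicovariance compatibility
    ∧ (∀ (α β γ : G) (ρ : I → A (α * β * γ)),
      (TensorProduct.assoc k (A α) (I → A β) (A γ))
          ((LinearMap.rTensor (A γ) (DlFree A Δ I α β (α * β) rfl))
            (DrFree A Δ I Rm (α * β) γ (α * β * γ) rfl ρ))
        = (LinearMap.lTensor (A α) (DrFree A Δ I Rm β γ (β * γ) rfl))
            (DlFree A Δ I α (β * γ) (α * β * γ) (mul_assoc α β γ).symm ρ)) := by
  have hf₁ : ∀ (a b : A 1) (i j : I), f i j 1 (a * b) = ∑ h, f i h 1 a * f h j 1 b :=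
    hf_mul 1
  refine ⟨?_, ?_, ?_, ?_, ?_, ?_, ?_, ?_, ?_, ?_, ?_, ?_, ?_, ?_⟩
  · intro α a b v
    funext i
    simp [mul_assoc]
  · intro α v
    funext i
    simp
  · intro α a b v
    funext j
    simp only [piSr_apply, fstarb_mul (fun i j => f i j 1) hf₁, Finset.mul_sum, Finset.sum_mul,
      mul_assoc]
    exact Finset.sum_comm
  · intro α v
    funext j
    simp [piSr_apply, fstarb_one, hf_one]
  · intro α a b v
    funext j
    simp [piSr_apply, Finset.mul_sum, mul_assoc]
  · intro α β γ h a ρ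
    simp [DlFree_apply, tact_mul_piSl_lTensor_single]
  · intro α β γ h a ρ
    simp only [DlFree_apply, map_sum, tact_flip_piSr_lTensor_single, piSr_apply, map_mul,
      comul_fstarb hcoassoc]
    exact Finset.sum_comm
  · exact DlFree_coassoc hcoassoc
  · exact DlFree_counit ε hcounit₂
  · intro α β γ h a ρ
    simp [DrFree_apply, tact_piSl_mul_map_single_mulRight]
  · exact DrFree_piSr hcoassoc Rm (fun i j => f i j 1) hRf
  · exact DrFree_coassoc hcoassoc Rm hRΔ
  · exact DrFree_counit ε hcounit₁ Rm hRε
  · exact DlFree_DrFree_comm hcoassoc Rm
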